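/- For every positive integer n and every nonnegative integer k, the complete homogeneous symmetric polynomial of degree k in the binomial(n+1,2) variables {x_i x_j : 1 ≤ i ≤ j ≤ n} equals the sum of the Schur polynomials s_λ(x_1,…,x_n) over all partitions λ of 2k with all parts even. -/

import Mathlib

/-- The weight of a semistandard Young tableau: `ssytWeight T i` is the number of cells of the
tableau whose entry equals `i`. -/
def ssytWeight {μ : YoungDiagram} (T : SemistandardYoungTableau μ) (i : ℕ) : ℕ :=
  (μ.cells.filter fun c => T c.1 c.2 = i).card

/-- `tabCard μ ν` is the number of semistandard Young tableaux of shape `μ` and weight `ν`,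
where `ν : Fin n → ℕ`: the entry `j` (for `j < n`) occurs exactly `ν j` times, and no entry
`≥ n` occurs. -/
noncomputable def tabCard (μ : YoungDiagram) {n : ℕ} (ν : Fin n → ℕ) : ℕ :=
  Set.ncard {T : SemistandardYoungTableau μ |
    ∀ j : ℕ, ssytWeight T j = if h : j < n then ν ⟨j, h⟩ else 0}

/-- The Schur polynomial `s_μ(x_0, …, x_{n-1})`, as the generating function of semistandard
Young tableaux of shape `μ` with entries in `{0, …, n-1}`. -/
noncomputable def schurPoly (n : ℕ) (μ : YoungDiagram) : MvPolynomial (Fin n) ℤ :=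
  ∑ᶠ (T : SemistandardYoungTableau μ) (_ : ∀ c ∈ μ.cells, T c.1 c.2 < n),
    ∏ i : Fin n, (MvPolynomial.X i : MvPolynomial (Fin n) ℤ) ^ ssytWeight T (i : ℕ)

/-- The number of odd rows (odd parts) of a Young diagram. -/
def oddRowsCount (lam : YoungDiagram) : ℕ :=
  lam.rowLens.countP fun r => r % 2 = 1

/-- The number of odd columns of a Young diagram. -/
def oddColsCount (lam : YoungDiagram) : ℕ :=
  oddRowsCount lam.transpose

/-- A Young diagram is a *threshold* partition if its Frobenius coordinates satisfy
`β i = α i + 1` for each `i` up to the Durfee rank; with 0-indexed diagrams this says that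
`colLen i = rowLen i + 1` for each diagonal cell `(i, i)`. -/
def YoungDiagram.IsThreshold (lam : YoungDiagram) : Prop :=
  ∀ i : ℕ, (i, i) ∈ lam → lam.colLen i = lam.rowLen i + 1

open scoped ENNReal

namespace YoungDiagram

/-- The Young diagram whose row lengths are given by an antitone function vanishing at `N`. -/
def ofRowFun (f : ℕ → ℕ) (hf : Antitone f) (N : ℕ) : YoungDiagram where
  cells := (Finset.range N ×ˢ Finset.range (f 0)).filter fun c => c.2 < f c.1
  isLowerSet := by
    rintro ⟨i, j⟩ ⟨i', j'⟩ h hc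
    obtain ⟨h1, h2⟩ := Prod.mk_le_mk.1 h
    simp only [Finset.coe_filter, Finset.mem_product, Finset.mem_range, Set.mem_ofPred_eq] at hc ⊢
    have := hf h1
    omega

theorem rowLen_ofRowFun {f : ℕ → ℕ} (hf : Antitone f) {N : ℕ} (hN : f N = 0) (i : ℕ) :
    (ofRowFun f hf N).rowLen i = f i := by
  refine eq_of_forall_lt_iff fun j => ?_
  rw [← mem_iff_lt_rowLen, ← mem_cells]
  simp only [ofRowFun, Finset.mem_filter, Finset.mem_product, Finset.mem_range]
  refine ⟨fun h => h.2, fun h => ⟨⟨?_, h.trans_le (hf (Nat.zero_le i))⟩, h⟩⟩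
  by_contra! hi
  have := hf hi
  omega

theorem ext_rowLen {μ ν : YoungDiagram} (h : ∀ i, μ.rowLen i = ν.rowLen i) : μ = ν := by
  ext ⟨i, j⟩
  rw [mem_cells, mem_cells, mem_iff_lt_rowLen, mem_iff_lt_rowLen, h]

theorem rowLen_eq_zero {μ : YoungDiagram} {i : ℕ} (hi : μ.colLen 0 ≤ i) : μ.rowLen i = 0 := by
  by_contra! h
  have := mem_iff_lt_colLen.1 (mem_iff_lt_rowLen.2 (Nat.pos_of_ne_zero h))
  omega

theorem card_eq_sum_rowLen (μ : YoungDiagram) {N : ℕ} (hN : μ.rowLen N = 0) :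
    μ.card = ∑ i ∈ Finset.range N, μ.rowLen i := by
  have hmaps : ∀ c ∈ μ.cells, c.1 ∈ Finset.range N := by
    rintro ⟨i, j⟩ hc
    rw [mem_cells, mem_iff_lt_rowLen] at hc
    by_contra! hi
    have := μ.rowLen_anti N i (by simpa using hi)
    omega
  rw [YoungDiagram.card, Finset.card_eq_sum_card_fiberwise hmaps]
  exact Finset.sum_congr rfl fun i _ => (rowLen_eq_card μ).symm

theorem le_iff_rowLen_le {μ ν : YoungDiagram} : μ ≤ ν ↔ ∀ i, μ.rowLen i ≤ ν.rowLen i := by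
  refine ⟨fun h i => le_of_forall_lt fun j hj => ?_, fun h => ?_⟩
  · rw [← mem_iff_lt_rowLen] at hj ⊢
    exact h hj
  · rintro ⟨i, j⟩ hc
    have hc : (i, j) ∈ μ := hc
    show (i, j) ∈ ν
    rw [mem_iff_lt_rowLen] at hc ⊢
    exact hc.trans_le (h i)

theorem rowLen_sup (μ ν : YoungDiagram) (i : ℕ) :
    (μ ⊔ ν).rowLen i = max (μ.rowLen i) (ν.rowLen i) := by
  refine eq_of_forall_lt_iff fun j => ?_
  simp only [← mem_iff_lt_rowLen, mem_sup, lt_max_iff]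

theorem rowLen_inf (μ ν : YoungDiagram) (i : ℕ) :
    (μ ⊓ ν).rowLen i = min (μ.rowLen i) (ν.rowLen i) := by
  refine eq_of_forall_lt_iff fun j => ?_
  simp only [← mem_iff_lt_rowLen, mem_inf, lt_min_iff]

theorem rowLen_bot (i : ℕ) : (⊥ : YoungDiagram).rowLen i = 0 := by
  by_contra! h
  exact notMem_bot _ (mem_iff_lt_rowLen.2 (Nat.pos_of_ne_zero h))

theorem card_sup_add_card_inf (μ ν : YoungDiagram) :
    (μ ⊔ ν).card + (μ ⊓ ν).card = μ.card + ν.card := by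
  simp only [YoungDiagram.card, cells_sup, cells_inf, Finset.card_union_add_card_inter]

/-- `μ.IsHorizontalStrip ν` says that `μ ⊆ ν` and the skew diagram `ν / μ` has at most one cell
in each column. -/
def IsHorizontalStrip (μ ν : YoungDiagram) : Prop :=
  ∀ i, μ.rowLen i ≤ ν.rowLen i ∧ ν.rowLen (i + 1) ≤ μ.rowLen i

theorem IsHorizontalStrip.le {μ ν : YoungDiagram} (h : μ.IsHorizontalStrip ν) : μ ≤ ν :=
  le_iff_rowLen_le.2 fun i => (h i).1

theorem card_mono {μ ν : YoungDiagram} (h : μ ≤ ν) : μ.card ≤ ν.card :=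
  Finset.card_le_card (cells_subset_iff.2 h)

/-- Row lengths divisible by `s`, each row from the second on squeezed between the corresponding
row of `M` and the preceding row of `m`, and the first row at least as long as that of `M`. -/
def IsAbove (s : ℕ) (M m lam : YoungDiagram) : Prop :=
  (∀ i, s ∣ lam.rowLen i) ∧ M.rowLen 0 ≤ lam.rowLen 0 ∧
    ∀ i, M.rowLen (i + 1) ≤ lam.rowLen (i + 1) ∧ lam.rowLen (i + 1) ≤ m.rowLen i

/-- Row lengths divisible by `s`, each row squeezed between the next row of `M` and the
corresponding row of `m`. -/
def IsBelow (s : ℕ) (M m kap : YoungDiagram) : Prop :=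
  (∀ i, s ∣ kap.rowLen i) ∧ ∀ i, M.rowLen (i + 1) ≤ kap.rowLen i ∧ kap.rowLen i ≤ m.rowLen i

section Reflection

variable {s : ℕ} {M m : YoungDiagram}

/-- Reflect each row of `lam` except the first in the interval that contains it. -/
def reflectDown (s : ℕ) (hmM : m ≤ M) (lam : {lam : YoungDiagram // IsAbove s M m lam}) :
    YoungDiagram :=
  ofRowFun (fun i => M.rowLen (i + 1) + m.rowLen i - lam.1.rowLen (i + 1))
    (antitone_nat_of_succ_le fun i => by
      have h1 := lam.2.2.2 i
      have h2 := lam.2.2.2 (i + 1)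
      have := le_iff_rowLen_le.1 hmM (i + 1)
      omega)
    (M.colLen 0)

/-- Reflect each row of `kap` in the interval that contains it, and add a first row. -/
def reflectUp (s : ℕ) (hmM : m ≤ M) (kap : {kap : YoungDiagram // IsBelow s M m kap}) (d : ℕ) :
    YoungDiagram :=
  ofRowFun (fun i => i.casesOn (M.rowLen 0 + s * d)
      fun i => M.rowLen (i + 1) + m.rowLen i - kap.1.rowLen i)
    (antitone_nat_of_succ_le fun i => by
      cases i with
      | zero =>
        have h1 := kap.2.2 0
        have := le_iff_rowLen_le.1 hmM 0
        show M.rowLen (0 + 1) + m.rowLen 0 - kap.1.rowLen 0 ≤ M.rowLen 0 + s * d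
        omega
      | succ i =>
        have h1 := kap.2.2 i
        have h2 := kap.2.2 (i + 1)
        have := le_iff_rowLen_le.1 hmM (i + 1)
        dsimp only
        omega)
    (M.colLen 0 + 1)

theorem rowLen_colLen_zero_of_le (hmM : m ≤ M) :
    m.rowLen (M.colLen 0) = 0 ∧ M.rowLen (M.colLen 0) = 0 ∧ M.rowLen (M.colLen 0 + 1) = 0 := by
  have h1 := rowLen_eq_zero (μ := M) le_rfl
  have h2 := le_iff_rowLen_le.1 hmM (M.colLen 0)
  exact ⟨by omega, h1, rowLen_eq_zero (Nat.le_succ _)⟩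

theorem rowLen_reflectDown (hmM : m ≤ M) (lam : {lam : YoungDiagram // IsAbove s M m lam})
    (i : ℕ) :
    (reflectDown s hmM lam).rowLen i = M.rowLen (i + 1) + m.rowLen i - lam.1.rowLen (i + 1) :=
  rowLen_ofRowFun _ (by have := rowLen_colLen_zero_of_le hmM; omega) i

theorem rowLen_reflectUp_zero (hmM : m ≤ M) (kap : {kap : YoungDiagram // IsBelow s M m kap})
    (d : ℕ) : (reflectUp s hmM kap d).rowLen 0 = M.rowLen 0 + s * d :=
  rowLen_ofRowFun _ (by have := rowLen_colLen_zero_of_le hmM; dsimp only; omega) 0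

theorem rowLen_reflectUp_succ (hmM : m ≤ M) (kap : {kap : YoungDiagram // IsBelow s M m kap})
    (d i : ℕ) :
    (reflectUp s hmM kap d).rowLen (i + 1) =
      M.rowLen (i + 1) + m.rowLen i - kap.1.rowLen i :=
  rowLen_ofRowFun _ (by have := rowLen_colLen_zero_of_le hmM; dsimp only; omega) (i + 1)

/-- Reflection of rows is a bijection from the diagrams above `(M, m)` to the diagrams below
`(M, m)` together with the excess of the first row. -/
def reflectEquiv (hs : 0 < s) (hmM : m ≤ M) (hM : ∀ i, s ∣ M.rowLen i)
    (hm : ∀ i, s ∣ m.rowLen i) :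
    {lam : YoungDiagram // IsAbove s M m lam} ≃
      {kap : YoungDiagram // IsBelow s M m kap} × ℕ where
  toFun lam := ⟨⟨reflectDown s hmM lam, by
    refine ⟨fun i => ?_, fun i => ?_⟩
    · rw [rowLen_reflectDown]
      exact Nat.dvd_sub (dvd_add (hM _) (hm _)) (lam.2.1 _)
    · rw [rowLen_reflectDown]
      have := lam.2.2.2 i
      omega⟩, (lam.1.rowLen 0 - M.rowLen 0) / s⟩
  invFun p := ⟨reflectUp s hmM p.1 p.2, by
    refine ⟨fun i => ?_, ?_, fun i => ?_⟩
    · cases i with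
      | zero =>
        rw [rowLen_reflectUp_zero]
        exact dvd_add (hM _) (dvd_mul_right _ _)
      | succ i =>
        rw [rowLen_reflectUp_succ]
        exact Nat.dvd_sub (dvd_add (hM _) (hm _)) (p.1.2.1 _)
    · rw [rowLen_reflectUp_zero]
      exact Nat.le_add_right _ _
    · rw [rowLen_reflectUp_succ]
      have := p.1.2.2 i
      omega⟩
  left_inv lam := by
    refine Subtype.ext (ext_rowLen fun i => ?_)
    cases i with
    | zero =>
      have := lam.2.2.1
      rw [rowLen_reflectUp_zero, Nat.mul_div_cancel' (Nat.dvd_sub (lam.2.1 0) (hM 0))]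
      omega
    | succ i =>
      have := lam.2.2.2 i
      rw [rowLen_reflectUp_succ, rowLen_reflectDown]
      omega
  right_inv p := by
    refine Prod.ext (Subtype.ext (ext_rowLen fun i => ?_)) ?_
    · have := p.1.2.2 i
      rw [rowLen_reflectDown, rowLen_reflectUp_succ]
      omega
    · simp only [rowLen_reflectUp_zero, Nat.add_sub_cancel_left]
      exact Nat.mul_div_cancel_left _ hs

theorem card_reflectDown (hmM : m ≤ M) (hM : ∀ i, s ∣ M.rowLen i)
    (lam : {lam : YoungDiagram // IsAbove s M m lam}) :
    lam.1.card + (reflectDown s hmM lam).card =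
      s * ((lam.1.rowLen 0 - M.rowLen 0) / s) + M.card + m.card := by
  obtain ⟨h1, h2, h3⟩ := rowLen_colLen_zero_of_le hmM
  have hl := lam.2.2.2 (M.colLen 0)
  rw [Nat.mul_div_cancel' (Nat.dvd_sub (lam.2.1 0) (hM 0)),
    lam.1.card_eq_sum_rowLen (N := M.colLen 0 + 1) (by omega),
    M.card_eq_sum_rowLen (N := M.colLen 0 + 1) h3, m.card_eq_sum_rowLen h1,
    (reflectDown s hmM lam).card_eq_sum_rowLen (N := M.colLen 0)
      (by rw [rowLen_reflectDown]; omega),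
    Finset.sum_range_succ', Finset.sum_range_succ']
  have key : ∑ i ∈ Finset.range (M.colLen 0), lam.1.rowLen (i + 1) +
      ∑ i ∈ Finset.range (M.colLen 0), (reflectDown s hmM lam).rowLen i =
      ∑ i ∈ Finset.range (M.colLen 0), M.rowLen (i + 1) +
      ∑ i ∈ Finset.range (M.colLen 0), m.rowLen i := by
    rw [← Finset.sum_add_distrib, ← Finset.sum_add_distrib]
    refine Finset.sum_congr rfl fun i _ => ?_
    have := lam.2.2.2 i
    rw [rowLen_reflectDown]
    omega
  have := lam.2.2.1
  omega

open Classical in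
theorem tsum_isAbove (hs : 0 < s) (hmM : m ≤ M) (hM : ∀ i, s ∣ M.rowLen i)
    (hm : ∀ i, s ∣ m.rowLen i) (F : YoungDiagram → ℝ≥0∞) (z : ℝ≥0∞) (G : YoungDiagram → ℝ≥0∞)
    (h : ∀ lam kap d, IsAbove s M m lam → IsBelow s M m kap →
      lam.card + kap.card = s * d + M.card + m.card → F lam = z ^ d * G kap) :
    (∑' lam, if IsAbove s M m lam then F lam else 0) =
      (∑' d : ℕ, z ^ d) * ∑' kap, if IsBelow s M m kap then G kap else 0 := by
  have hF : ∑' lam : {lam // IsAbove s M m lam}, F lam = _ :=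
    tsum_subtype {lam | IsAbove s M m lam} F
  have hG : ∑' kap : {kap // IsBelow s M m kap}, G kap = _ :=
    tsum_subtype {kap | IsBelow s M m kap} G
  simp only [Set.indicator, Set.mem_ofPred_eq] at hF hG
  rw [← hF, ← hG]
  calc ∑' lam : {lam // IsAbove s M m lam}, F lam
      = ∑' lam, z ^ (reflectEquiv hs hmM hM hm lam).2 * G (reflectEquiv hs hmM hM hm lam).1 :=
        tsum_congr fun lam =>
          h _ _ _ lam.2 (reflectEquiv hs hmM hM hm lam).1.2 (card_reflectDown hmM hM lam)
    _ = ∑' p : {kap // IsBelow s M m kap} × ℕ, z ^ p.2 * G p.1 :=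
        (reflectEquiv hs hmM hM hm).tsum_eq fun p => z ^ p.2 * G p.1
    _ = _ := by
        rw [ENNReal.tsum_prod', ENNReal.tsum_comm]
        simp only [ENNReal.tsum_mul_left, ENNReal.tsum_mul_right]

end Reflection

open Classical in
/-- The weight `x ^ |ν / μ|` of a horizontal strip, and zero on other pairs of diagrams. -/
noncomputable def stripWeight (x : ℝ≥0∞) (μ ν : YoungDiagram) : ℝ≥0∞ :=
  if μ.IsHorizontalStrip ν then x ^ (ν.card - μ.card) else 0

/-- The Cauchy commutation relation between adding and removing horizontal strips. -/
theorem tsum_stripWeight_mul_stripWeight (x y : ℝ≥0∞) (μ ν : YoungDiagram) :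
    ∑' lam, stripWeight y μ lam * stripWeight x ν lam =
      (∑' d : ℕ, (x * y) ^ d) * ∑' kap, stripWeight x kap μ * stripWeight y kap ν := by
  classical
  have hA (lam) : IsAbove 1 (μ ⊔ ν) (μ ⊓ ν) lam ↔
      μ.IsHorizontalStrip lam ∧ ν.IsHorizontalStrip lam := by
    simp only [IsAbove, IsHorizontalStrip, rowLen_sup, rowLen_inf, one_dvd, implies_true,
      true_and, max_le_iff, le_min_iff]
    refine ⟨fun h => ⟨fun i => ?_, fun i => ?_⟩, fun h => ⟨⟨(h.1 0).1, (h.2 0).1⟩, fun i =>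
      ⟨⟨(h.1 _).1, (h.2 _).1⟩, (h.1 i).2, (h.2 i).2⟩⟩⟩
    · exact ⟨i.casesOn h.1.1 fun i => (h.2 i).1.1, (h.2 i).2.1⟩
    · exact ⟨i.casesOn h.1.2 fun i => (h.2 i).1.2, (h.2 i).2.2⟩
  have hB (kap) : IsBelow 1 (μ ⊔ ν) (μ ⊓ ν) kap ↔
      kap.IsHorizontalStrip μ ∧ kap.IsHorizontalStrip ν := by
    simp only [IsBelow, IsHorizontalStrip, rowLen_sup, rowLen_inf, one_dvd, implies_true,
      true_and, max_le_iff, le_min_iff, ← forall_and]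
    exact forall_congr' fun i => by tauto
  have hl (lam) : stripWeight y μ lam * stripWeight x ν lam =
      if IsAbove 1 (μ ⊔ ν) (μ ⊓ ν) lam then
        y ^ (lam.card - μ.card) * x ^ (lam.card - ν.card) else 0 := by
    rw [if_congr (hA lam) rfl rfl, ite_and, stripWeight, stripWeight]
    split_ifs <;> simp
  have hk (kap) : stripWeight x kap μ * stripWeight y kap ν =
      if IsBelow 1 (μ ⊔ ν) (μ ⊓ ν) kap then
        x ^ (μ.card - kap.card) * y ^ (ν.card - kap.card) else 0 := by
    rw [if_congr (hB kap) rfl rfl, ite_and, stripWeight, stripWeight]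
    split_ifs <;> simp
  simp only [hl, hk]
  refine tsum_isAbove one_pos (inf_le_left.trans le_sup_left) (fun _ => one_dvd _)
    (fun _ => one_dvd _) _ _ _ fun lam kap d h1 h2 hc => ?_
  have hlam := (hA lam).1 h1
  have hkap := (hB kap).1 h2
  have := card_sup_add_card_inf μ ν
  have := card_mono hkap.1.le
  have := card_mono hkap.2.le
  rw [show lam.card - μ.card = d + (ν.card - kap.card) by omega,
    show lam.card - ν.card = d + (μ.card - kap.card) by omega]
  ring

open Classical in
/-- The indicator function of the diagrams with all rows of even length. -/
noncomputable def evenRows (lam : YoungDiagram) : ℝ≥0∞ :=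
  if ∀ i, 2 ∣ lam.rowLen i then 1 else 0

/-- Round all rows up to even length. -/
def roundUp (μ : YoungDiagram) : YoungDiagram :=
  ofRowFun (fun i => 2 * ((μ.rowLen i + 1) / 2))
    (fun i j h => by have := μ.rowLen_anti i j h; dsimp only; omega) (μ.colLen 0)

/-- Round all rows down to even length. -/
def roundDown (μ : YoungDiagram) : YoungDiagram :=
  ofRowFun (fun i => 2 * (μ.rowLen i / 2))
    (fun i j h => by have := μ.rowLen_anti i j h; dsimp only; omega) (μ.colLen 0)

theorem rowLen_roundUp (μ : YoungDiagram) (i : ℕ) :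
    μ.roundUp.rowLen i = 2 * ((μ.rowLen i + 1) / 2) :=
  rowLen_ofRowFun _ (by simp [rowLen_eq_zero]) i

theorem rowLen_roundDown (μ : YoungDiagram) (i : ℕ) :
    μ.roundDown.rowLen i = 2 * (μ.rowLen i / 2) :=
  rowLen_ofRowFun _ (by simp [rowLen_eq_zero]) i

theorem card_roundUp_add_card_roundDown (μ : YoungDiagram) :
    μ.roundUp.card + μ.roundDown.card = 2 * μ.card := by
  have h := rowLen_eq_zero (μ := μ) le_rfl
  rw [μ.card_eq_sum_rowLen h, μ.roundUp.card_eq_sum_rowLen (N := μ.colLen 0),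
    μ.roundDown.card_eq_sum_rowLen (N := μ.colLen 0), ← Finset.sum_add_distrib, Finset.mul_sum]
  · refine Finset.sum_congr rfl fun i _ => ?_
    rw [rowLen_roundUp, rowLen_roundDown]
    omega
  · simp [rowLen_roundDown, h]
  · simp [rowLen_roundUp, h]

/-- Up to a factor `1 / (1 - x ^ 2)`, removing and adding a horizontal strip have the same effect
on the sum of all diagrams with even rows. -/
theorem tsum_stripWeight_mul_evenRows (x : ℝ≥0∞) (μ : YoungDiagram) :
    ∑' lam, stripWeight x μ lam * evenRows lam =
      (∑' d : ℕ, (x * x) ^ d) * ∑' kap, stripWeight x kap μ * evenRows kap := by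
  classical
  have hA (lam) : IsAbove 2 μ.roundUp μ.roundDown lam ↔
      μ.IsHorizontalStrip lam ∧ ∀ i, 2 ∣ lam.rowLen i := by
    simp only [IsAbove, IsHorizontalStrip, rowLen_roundUp, rowLen_roundDown]
    constructor
    · rintro ⟨h, h0, h1⟩
      refine ⟨fun i => ⟨?_, ?_⟩, h⟩
      · cases i with
        | zero => omega
        | succ i => have := h1 i; omega
      · have := h1 i; omega
    · rintro ⟨h1, h⟩
      refine ⟨h, ?_, fun i => ?_⟩
      · have := h1 0; have := h 0; omega
      · have := h1 i; have := h1 (i + 1); have := h (i + 1); omega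
  have hB (kap) : IsBelow 2 μ.roundUp μ.roundDown kap ↔
      kap.IsHorizontalStrip μ ∧ ∀ i, 2 ∣ kap.rowLen i := by
    simp only [IsBelow, IsHorizontalStrip, rowLen_roundUp, rowLen_roundDown]
    constructor
    · rintro ⟨h, h1⟩
      exact ⟨fun i => by have := h1 i; omega, h⟩
    · rintro ⟨h1, h⟩
      exact ⟨h, fun i => by have := h1 i; have := h i; omega⟩
  have hl (lam) : stripWeight x μ lam * evenRows lam =
      if IsAbove 2 μ.roundUp μ.roundDown lam then x ^ (lam.card - μ.card) else 0 := by
    rw [if_congr (hA lam) rfl rfl, ite_and, stripWeight, evenRows]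
    split_ifs <;> simp
  have hk (kap) : stripWeight x kap μ * evenRows kap =
      if IsBelow 2 μ.roundUp μ.roundDown kap then x ^ (μ.card - kap.card) else 0 := by
    rw [if_congr (hB kap) rfl rfl, ite_and, stripWeight, evenRows]
    split_ifs <;> simp
  simp only [hl, hk]
  refine tsum_isAbove two_pos (le_iff_rowLen_le.2 fun i => ?_) (fun i => ?_) (fun i => ?_) _ _ _
    fun lam kap d h1 h2 hc => ?_
  · rw [rowLen_roundUp, rowLen_roundDown]
    omega
  · simp [rowLen_roundUp]
  · simp [rowLen_roundDown]
  have hkap := (hB kap).1 h2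
  have := card_roundUp_add_card_roundDown μ
  have := card_mono hkap.1.le
  rw [show lam.card - μ.card = 2 * d + (μ.card - kap.card) by omega]
  ring

end YoungDiagram

open YoungDiagram

namespace SemistandardYoungTableau

variable {lam μ : YoungDiagram} {n : ℕ}

/-- The subdiagram of cells whose entry is less than `n`. -/
def subdiagram (T : SemistandardYoungTableau lam) (n : ℕ) : YoungDiagram where
  cells := lam.cells.filter fun c => T c.1 c.2 < n
  isLowerSet := by
    rintro ⟨i, j⟩ ⟨i', j'⟩ h hc
    obtain ⟨h1, h2⟩ := Prod.mk_le_mk.1 h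
    simp only [Finset.coe_filter, mem_cells, Set.mem_ofPred_eq] at hc ⊢
    exact ⟨lam.up_left_mem h1 h2 hc.1, ((T.col_weak h1 (lam.up_left_mem le_rfl h2 hc.1)).trans
      (T.row_weak_of_le h2 hc.1)).trans_lt hc.2⟩

theorem mem_subdiagram {T : SemistandardYoungTableau lam} {i j : ℕ} :
    (i, j) ∈ T.subdiagram n ↔ (i, j) ∈ lam ∧ T i j < n := by
  rw [← mem_cells]
  simp [subdiagram]

/-- All entries are less than `n`. -/
def IsBounded (n : ℕ) (T : SemistandardYoungTableau lam) : Prop :=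
  ∀ c ∈ lam.cells, T c.1 c.2 < n

theorem IsBounded.lt {T : SemistandardYoungTableau lam} (h : T.IsBounded n) {i j : ℕ}
    (hij : (i, j) ∈ lam) : T i j < n :=
  h (i, j) hij

theorem IsBounded.isHorizontalStrip_subdiagram {T : SemistandardYoungTableau lam}
    (h : T.IsBounded (n + 1)) : (T.subdiagram n).IsHorizontalStrip lam := by
  refine fun i => ⟨le_of_forall_lt fun j hj => ?_, le_of_forall_lt fun j hj => ?_⟩
  · rw [← mem_iff_lt_rowLen] at hj ⊢
    exact (mem_subdiagram.1 hj).1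
  · rw [← mem_iff_lt_rowLen] at hj ⊢
    have := T.col_strict (Nat.lt_add_one i) hj
    have := h.lt hj
    exact mem_subdiagram.2 ⟨lam.up_left_mem (Nat.le_succ i) le_rfl hj, by omega⟩

/-- Restriction of a tableau to a smaller diagram. -/
def restrict (T : SemistandardYoungTableau lam) (h : μ ≤ lam) : SemistandardYoungTableau μ where
  entry i j := if (i, j) ∈ μ then T i j else 0
  row_weak' hj hc := by
    rw [if_pos hc, if_pos (μ.up_left_mem le_rfl hj.le hc)]
    exact T.row_weak hj (h hc)
  col_strict' hi hc := by
    rw [if_pos hc, if_pos (μ.up_left_mem hi.le le_rfl hc)]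
    exact T.col_strict hi (h hc)
  zeros' hc := if_neg hc

theorem restrict_apply (T : SemistandardYoungTableau lam) (h : μ ≤ lam) (i j : ℕ) :
    T.restrict h i j = if (i, j) ∈ μ then T i j else 0 :=
  rfl

/-- Extension of a tableau with entries less than `n` along a horizontal strip filled with `n`. -/
def extend (T : SemistandardYoungTableau μ) (hT : T.IsBounded n) (h : μ.IsHorizontalStrip lam) :
    SemistandardYoungTableau lam where
  entry i j := if (i, j) ∈ μ then T i j else if (i, j) ∈ lam then n else 0
  row_weak' {i j1 j2} hj hc := by
    by_cases h2 : (i, j2) ∈ μ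
    · rw [if_pos h2, if_pos (μ.up_left_mem le_rfl hj.le h2)]
      exact T.row_weak hj h2
    · rw [if_neg h2, if_pos hc]
      split_ifs with h3
      · exact (hT.lt h3).le
      · exact le_rfl
      · exact Nat.zero_le _
  col_strict' {i1 i2 j} hi hc := by
    have h1 : (i1, j) ∈ μ := by
      have := mem_iff_lt_rowLen.1 (lam.up_left_mem (Nat.succ_le_of_lt hi) le_rfl hc)
      exact mem_iff_lt_rowLen.2 (this.trans_le (h i1).2)
    rw [if_pos h1]
    by_cases h2 : (i2, j) ∈ μ
    · rw [if_pos h2]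
      exact T.col_strict hi h2
    · rw [if_neg h2, if_pos hc]
      exact hT.lt h1
  zeros' {i j} hc := by rw [if_neg fun h' => hc (h.le h'), if_neg hc]

theorem extend_apply (T : SemistandardYoungTableau μ) (hT : T.IsBounded n)
    (h : μ.IsHorizontalStrip lam) (i j : ℕ) :
    T.extend hT h i j = if (i, j) ∈ μ then T i j else if (i, j) ∈ lam then n else 0 :=
  rfl

/-- Tableaux with entries at most `n` whose entries less than `n` occupy `μ` correspond to tableaux
of shape `μ` with entries less than `n`. -/
def restrictEquiv (h : μ.IsHorizontalStrip lam) :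
    {T : {T : SemistandardYoungTableau lam // T.IsBounded (n + 1)} // T.1.subdiagram n = μ} ≃
      {T : SemistandardYoungTableau μ // T.IsBounded n} where
  toFun T := ⟨T.1.1.restrict h.le, fun ⟨i, j⟩ hc => by
    have hc : (i, j) ∈ μ := hc
    rw [restrict_apply, if_pos hc]
    rw [← T.2] at hc
    exact (mem_subdiagram.1 hc).2⟩
  invFun T := ⟨⟨T.1.extend T.2 h, fun ⟨i, j⟩ hc => by
    rw [extend_apply]
    split_ifs with h1
    · exact (T.2.lt h1).trans (Nat.lt_succ_self n)
    · exact Nat.lt_succ_self n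
    · exact Nat.succ_pos n⟩, by
    ext ⟨i, j⟩
    rw [mem_cells, mem_cells, mem_subdiagram, extend_apply]
    by_cases h1 : (i, j) ∈ μ
    · simp [h1, h.le h1, T.2.lt h1]
    · by_cases h2 : (i, j) ∈ lam <;> simp [h1, h2]⟩
  left_inv T := by
    refine Subtype.ext (Subtype.ext (SemistandardYoungTableau.ext fun i j => ?_))
    have hT : (i, j) ∈ μ ↔ (i, j) ∈ lam ∧ T.1.1 i j < n := by rw [← mem_subdiagram, T.2]
    simp only [extend_apply, restrict_apply]
    split_ifs with h1 h2
    · rfl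
    · have := T.1.2.lt h2
      have := not_and.1 (mt hT.2 h1) h2
      omega
    · exact (T.1.1.zeros h2).symm
  right_inv T := by
    refine Subtype.ext (SemistandardYoungTableau.ext fun i j => ?_)
    simp only [extend_apply, restrict_apply]
    split_ifs with h1
    · rfl
    · exact (T.1.zeros h1).symm

end SemistandardYoungTableau

open SemistandardYoungTableau

/-- The Schur function `s_lam` evaluated at `x 0, …, x (n - 1)`. -/
noncomputable def schurSum (x : ℕ → ℝ≥0∞) (n : ℕ) (lam : YoungDiagram) : ℝ≥0∞ :=
  ∑' T : {T : SemistandardYoungTableau lam // T.IsBounded n},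
    ∏ c ∈ lam.cells, x (T.1 c.1 c.2)

theorem schurSum_zero (x : ℕ → ℝ≥0∞) {lam : YoungDiagram} (h : lam ≠ ⊥) :
    schurSum x 0 lam = 0 := by
  have : IsEmpty {T : SemistandardYoungTableau lam // T.IsBounded 0} := by
    refine ⟨fun T => h ?_⟩
    ext c
    simpa using fun hc => Nat.not_lt_zero _ (T.2 c hc)
  exact tsum_empty

theorem schurSum_zero_bot (x : ℕ → ℝ≥0∞) : schurSum x 0 ⊥ = 1 := by
  have : Unique {T : SemistandardYoungTableau ⊥ // T.IsBounded 0} :=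
    { default := ⟨default, by simp [IsBounded]⟩
      uniq := fun T => Subtype.ext (SemistandardYoungTableau.ext fun i j => by
        rw [T.1.zeros (notMem_bot _), SemistandardYoungTableau.zeros _ (notMem_bot _)]) }
  rw [schurSum, tsum_fintype]
  simp

/-- The branching rule for Schur functions. -/
theorem schurSum_succ (x : ℕ → ℝ≥0∞) (n : ℕ) (lam : YoungDiagram) :
    schurSum x (n + 1) lam = ∑' μ, schurSum x n μ * stripWeight (x n) μ lam := by
  rw [schurSum, ← (Equiv.sigmaFiberEquiv fun T :
    {T : SemistandardYoungTableau lam // T.IsBounded (n + 1)} => T.1.subdiagram n).tsum_eq,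
    ENNReal.tsum_sigma']
  refine tsum_congr fun μ => ?_
  by_cases h : μ.IsHorizontalStrip lam
  · rw [stripWeight, if_pos h, schurSum, ← (restrictEquiv h).tsum_eq, ← ENNReal.tsum_mul_right]
    refine tsum_congr fun T => ?_
    have hT (i j) : (i, j) ∈ μ ↔ (i, j) ∈ lam ∧ T.1.1 i j < n := by rw [← mem_subdiagram, T.2]
    have hsub := cells_subset_iff.2 h.le
    rw [YoungDiagram.card, YoungDiagram.card, ← Finset.card_sdiff_of_subset hsub,
      ← Finset.prod_const, mul_comm, ← Finset.prod_sdiff hsub]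
    congr 1
    · refine Finset.prod_congr rfl fun ⟨i, j⟩ hc => congrArg x ?_
      rw [Finset.mem_sdiff, mem_cells, mem_cells] at hc
      have := T.1.2.lt hc.1
      have := not_and.1 (mt (hT i j).2 hc.2) hc.1
      show T.1.1 i j = n
      omega
    · refine Finset.prod_congr rfl fun ⟨i, j⟩ hc => congrArg x ?_
      exact (if_pos hc).symm
  · have : IsEmpty {T : {T : SemistandardYoungTableau lam // T.IsBounded (n + 1)} //
        T.1.subdiagram n = μ} :=
      ⟨fun T => h (T.2 ▸ T.1.2.isHorizontalStrip_subdiagram)⟩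
    rw [stripWeight, if_neg h, mul_zero]
    exact tsum_empty

theorem tsum_schurSum_zero_mul (x : ℕ → ℝ≥0∞) (f : YoungDiagram → ℝ≥0∞) :
    ∑' lam, schurSum x 0 lam * f lam = f ⊥ := by
  rw [tsum_eq_single ⊥ fun lam h => by rw [schurSum_zero x h, zero_mul], schurSum_zero_bot,
    one_mul]

theorem tsum_schurSum_succ_mul (x : ℕ → ℝ≥0∞) (n : ℕ) (f : YoungDiagram → ℝ≥0∞) :
    ∑' lam, schurSum x (n + 1) lam * f lam =
      ∑' μ, schurSum x n μ * ∑' lam, stripWeight (x n) μ lam * f lam := by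
  simp only [schurSum_succ, ← ENNReal.tsum_mul_left, ← ENNReal.tsum_mul_right]
  rw [ENNReal.tsum_comm]
  simp only [mul_assoc]

/-- Pieri's rule, summed over all horizontal strips. -/
theorem tsum_schurSum_mul_stripWeight (x : ℕ → ℝ≥0∞) (y : ℝ≥0∞) (n : ℕ)
    (f : YoungDiagram → ℝ≥0∞) :
    ∑' μ, schurSum x n μ * ∑' kap, stripWeight y kap μ * f kap =
      (∏ i ∈ Finset.range n, ∑' d : ℕ, (x i * y) ^ d) * ∑' μ, schurSum x n μ * f μ := by
  induction n generalizing f with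
  | zero =>
    rw [tsum_schurSum_zero_mul, tsum_schurSum_zero_mul, Finset.prod_range_zero, one_mul,
      tsum_eq_single ⊥]
    · simp [stripWeight, IsHorizontalStrip, rowLen_bot]
    · intro kap hk
      rw [stripWeight, if_neg fun h => hk (le_bot_iff.1 h.le), zero_mul]
  | succ n ih =>
    have key (μ : YoungDiagram) :
        ∑' lam, stripWeight (x n) μ lam * ∑' ν, stripWeight y ν lam * f ν =
          (∑' d : ℕ, (x n * y) ^ d) *
            ∑' kap, stripWeight y kap μ * ∑' ν, stripWeight (x n) kap ν * f ν := by
      calc ∑' lam, stripWeight (x n) μ lam * ∑' ν, stripWeight y ν lam * f ν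
          = ∑' ν, (∑' lam, stripWeight (x n) μ lam * stripWeight y ν lam) * f ν := by
            simp only [← ENNReal.tsum_mul_left, ← ENNReal.tsum_mul_right]
            rw [ENNReal.tsum_comm]
            simp only [mul_assoc]
        _ = _ := by
            simp only [tsum_stripWeight_mul_stripWeight, mul_comm y, mul_assoc,
              ← ENNReal.tsum_mul_right]
            rw [ENNReal.tsum_comm]
            simp only [← ENNReal.tsum_mul_left]
            exact tsum_congr fun d => ENNReal.tsum_comm
    rw [tsum_schurSum_succ_mul, tsum_schurSum_succ_mul, Finset.prod_range_succ, mul_right_comm,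
      ← ih, mul_comm, ← ENNReal.tsum_mul_left]
    simp only [key, mul_left_comm]

/-- Littlewood's identity for the sum of Schur functions over diagrams with even rows. -/
theorem tsum_schurSum_mul_evenRows (x : ℕ → ℝ≥0∞) (n : ℕ) :
    ∑' lam, schurSum x n lam * evenRows lam =
      ∏ j ∈ Finset.range n, ∏ i ∈ Finset.range (j + 1), ∑' d : ℕ, (x i * x j) ^ d := by
  induction n with
  | zero => rw [tsum_schurSum_zero_mul]; simp [evenRows, rowLen_bot]
  | succ n ih =>
    rw [tsum_schurSum_succ_mul, Finset.prod_range_succ, ← ih, Finset.prod_range_succ _ n]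
    simp only [tsum_stripWeight_mul_evenRows, mul_left_comm (schurSum x n _),
      ENNReal.tsum_mul_left]
    rw [tsum_schurSum_mul_stripWeight]
    ring

open scoped NNReal

theorem ENNReal.le_coeff_of_tsum_eq {a b : ℕ → ℝ≥0∞}
    (h : ∀ u : ℝ≥0, ∑' k, (u : ℝ≥0∞) ^ k * a k = ∑' k, (u : ℝ≥0∞) ^ k * b k)
    (hb : ∑' k, b k ≠ ∞) {k : ℕ} (hk : ∀ j < k, a j = b j) : a k ≤ b k := by
  have hfin (j : ℕ) : b j ≠ ∞ := ENNReal.ne_top_of_tsum_ne_top hb j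
  have htail (u : ℝ≥0) (hu : u ≠ 0) :
      ∑' j, (u : ℝ≥0∞) ^ j * a (j + k) = ∑' j, (u : ℝ≥0∞) ^ j * b (j + k) := by
    have hsplit (c : ℕ → ℝ≥0∞) : ∑' j, c j = ∑ j ∈ Finset.range k, c j + ∑' j, c (j + k) :=
      (Summable.sum_add_tsum_nat_add' (f := c) ENNReal.summable).symm
    have hsum : ∑ j ∈ Finset.range k, (u : ℝ≥0∞) ^ j * a j =
        ∑ j ∈ Finset.range k, (u : ℝ≥0∞) ^ j * b j :=
      Finset.sum_congr rfl fun j hj => by rw [hk j (Finset.mem_range.1 hj)]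
    have hne : ∑ j ∈ Finset.range k, (u : ℝ≥0∞) ^ j * b j ≠ ∞ :=
      ENNReal.sum_ne_top.2 fun j _ =>
        ENNReal.mul_ne_top (ENNReal.pow_ne_top ENNReal.coe_ne_top) (hfin j)
    have h1 := h u
    rw [hsplit fun j => (u : ℝ≥0∞) ^ j * a j, hsplit fun j => (u : ℝ≥0∞) ^ j * b j, hsum,
      ENNReal.add_right_inj hne] at h1
    simp only [pow_add, mul_assoc, mul_left_comm _ ((u : ℝ≥0∞) ^ k), ENNReal.tsum_mul_left] at h1
    exact (ENNReal.mul_right_inj (pow_ne_zero k (by simpa using hu)) (by finiteness)).1 h1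
  have hle (u : ℝ≥0) (hu : u ≠ 0) (hu1 : u ≤ 1) : a k ≤ b k + u * ∑' j, b j := by
    calc a k = (u : ℝ≥0∞) ^ 0 * a (0 + k) := by simp
      _ ≤ ∑' j, (u : ℝ≥0∞) ^ j * a (j + k) :=
          ENNReal.le_tsum (f := fun j => (u : ℝ≥0∞) ^ j * a (j + k)) 0
      _ = ∑' j, (u : ℝ≥0∞) ^ j * b (j + k) := htail u hu
      _ = b k + ∑' j, (u : ℝ≥0∞) ^ (j + 1) * b (j + 1 + k) := by
          rw [tsum_eq_zero_add' ENNReal.summable]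
          simp
      _ ≤ b k + ∑' j, u * b (j + (1 + k)) := by
          gcongr with j
          · rw [pow_succ]
            exact mul_le_of_le_one_left' (pow_le_one' (by exact_mod_cast hu1) j)
          · rw [add_assoc]
      _ ≤ b k + u * ∑' j, b j := by
          rw [ENNReal.tsum_mul_left]
          refine add_le_add_right (mul_le_mul_right ?_ _) _
          exact ENNReal.tsum_comp_le_tsum_of_injective (add_left_injective (1 + k)) b
  refine ENNReal.le_of_forall_pos_le_add fun ε hε _ => ?_
  lift ∑' j, b j to ℝ≥0 using hb with B
  have hpos : 0 < min 1 (ε / (B + 1)) := lt_min one_pos (div_pos hε (by positivity))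
  refine (hle _ hpos.ne' (min_le_left _ _)).trans ?_
  gcongr
  norm_cast
  calc min 1 (ε / (B + 1)) * B ≤ ε / (B + 1) * (B + 1) :=
        mul_le_mul (min_le_right _ _) (le_add_of_nonneg_right zero_le_one) zero_le zero_le
    _ = ε := div_mul_cancel₀ _ (by positivity)

/-- Two power series with nonnegative coefficients that agree as functions have the same
coefficients, if one of them converges at `1`. -/
theorem ENNReal.coeff_eq_of_tsum_eq {a b : ℕ → ℝ≥0∞}
    (h : ∀ u : ℝ≥0, ∑' k, (u : ℝ≥0∞) ^ k * a k = ∑' k, (u : ℝ≥0∞) ^ k * b k)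
    (hb : ∑' k, b k ≠ ∞) (k : ℕ) : a k = b k := by
  have hab : ∑' k, a k = ∑' k, b k := by simpa using h 1
  induction k using Nat.strong_induction_on with
  | _ k ih =>
    exact le_antisymm (ENNReal.le_coeff_of_tsum_eq h hb ih)
      (ENNReal.le_coeff_of_tsum_eq (fun u => (h u).symm) (hab ▸ hb) fun j hj => (ih j hj).symm)

theorem ENNReal.prod_fin_tsum_pow {m : ℕ} (v : Fin m → ℝ≥0∞) :
    ∏ p, ∑' d : ℕ, v p ^ d = ∑' c : Fin m → ℕ, ∏ p, v p ^ c p := by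
  induction m with
  | zero => simp [tsum_fintype]
  | succ m ih =>
    rw [Fin.prod_univ_succ, ih, ← (Fin.consEquiv fun _ => ℕ).tsum_eq, ENNReal.tsum_prod',
      ← ENNReal.tsum_mul_right]
    simp [Fin.prod_univ_succ, ENNReal.tsum_mul_left]

/-- A product of geometric series is the sum of all complete homogeneous polynomials. -/
theorem ENNReal.prod_tsum_pow {σ : Type*} [Fintype σ] [DecidableEq σ] (v : σ → ℝ≥0∞) :
    ∏ p, ∑' d : ℕ, v p ^ d = ∑' k, ∑ s : Sym σ k, (s.1.map v).prod := by
  have e := Fintype.equivFin σ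
  calc ∏ p, ∑' d : ℕ, v p ^ d
      = ∏ p, ∑' d : ℕ, v (e.symm p) ^ d := (e.symm.prod_comp fun p => ∑' d : ℕ, v p ^ d).symm
    _ = ∑' c : σ → ℕ, ∏ p, v p ^ c p := by
        rw [ENNReal.prod_fin_tsum_pow, ← (e.arrowCongr (Equiv.refl ℕ)).tsum_eq]
        refine tsum_congr fun c => ?_
        rw [← e.symm.prod_comp]
        rfl
    _ = ∑' s : Multiset σ, (s.map v).prod := by
        rw [← (Multiset.toFinsupp.toEquiv.trans Finsupp.equivFunOnFinite).tsum_eq]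
        refine tsum_congr fun s => ?_
        rw [Finset.prod_multiset_map_count]
        symm
        refine Finset.prod_subset (Finset.subset_univ _) fun p _ hp => ?_
        rw [Multiset.count_eq_zero.2 (by simpa using hp), pow_zero]
    _ = _ := by
        rw [← (Equiv.sigmaFiberEquiv (Multiset.card : Multiset σ → ℕ)).tsum_eq,
          ENNReal.tsum_sigma']
        refine tsum_congr fun k => ?_
        change ∑' s : Sym σ k, (s.1.map v).prod = _
        exact tsum_fintype _

theorem Finset.prod_range_prod_range_succ {M : Type*} [CommMonoid M] (n : ℕ) (g : ℕ → ℕ → M) :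
    ∏ j ∈ Finset.range n, ∏ i ∈ Finset.range (j + 1), g i j =
      ∏ p : {p : Fin n × Fin n // p.1 ≤ p.2}, g p.1.1 p.1.2 := by
  rw [Finset.prod_sigma']
  symm
  refine Finset.prod_bij (fun p _ => ⟨p.1.2, p.1.1⟩) ?_ ?_ ?_ fun _ _ => rfl
  · rintro ⟨⟨i, j⟩, h⟩ _
    simpa [Nat.lt_succ_iff] using h
  · rintro ⟨⟨i, j⟩, h⟩ _ ⟨⟨i', j'⟩, h'⟩ _ he
    simp only [Sigma.mk.injEq, heq_eq_eq, Fin.val_inj] at he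
    simp [he]
  · rintro ⟨j, i⟩ h
    simp only [Finset.mem_sigma, Finset.mem_range] at h
    exact ⟨⟨(⟨i, by omega⟩, ⟨j, h.1⟩), Nat.lt_succ_iff.1 h.2⟩, Finset.mem_univ _, rfl⟩

/-- All rows have even length and there are `2 * k` cells. -/
def YoungDiagram.IsEvenOfCard (k : ℕ) (lam : YoungDiagram) : Prop :=
  lam.card = 2 * k ∧ ∀ r ∈ lam.rowLens, Even r

theorem YoungDiagram.forall_even_rowLens_iff {lam : YoungDiagram} :
    (∀ r ∈ lam.rowLens, Even r) ↔ ∀ i, 2 ∣ lam.rowLen i := by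
  simp only [rowLens, List.mem_map, List.mem_range, forall_exists_index, and_imp,
    forall_apply_eq_imp_iff₂, even_iff_two_dvd]
  refine ⟨fun h i => ?_, fun h i _ => h i⟩
  rcases lt_or_ge i (lam.colLen 0) with hi | hi
  · exact h i hi
  · simp [rowLen_eq_zero hi]

theorem YoungDiagram.two_dvd_card {lam : YoungDiagram} (h : ∀ i, 2 ∣ lam.rowLen i) :
    2 ∣ lam.card := by
  rw [lam.card_eq_sum_rowLen (rowLen_eq_zero le_rfl)]
  exact Finset.dvd_sum fun i _ => h i

theorem schurSum_mul (t : ℝ≥0∞) (x : ℕ → ℝ≥0∞) (n : ℕ) (lam : YoungDiagram) :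
    schurSum (fun i => t * x i) n lam = t ^ lam.card * schurSum x n lam := by
  simp only [schurSum, Finset.prod_mul_distrib, Finset.prod_const, ENNReal.tsum_mul_left,
    YoungDiagram.card]

/-- The graded form of Littlewood's identity, for small positive values of the variables. -/
theorem tsum_schurSum_isEvenOfCard (x : ℕ → ℝ≥0∞) (hx : ∀ i, x i < 1) (n k : ℕ) :
    ∑' lam : {lam : YoungDiagram // lam.IsEvenOfCard k}, schurSum x n lam =
      ∑ s : Sym {p : Fin n × Fin n // p.1 ≤ p.2} k,
        (s.1.map fun p => x p.1.1 * x p.1.2).prod := by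
  classical
  have heven (u : ℝ≥0) (lam : YoungDiagram) :
      schurSum (fun i => NNReal.sqrt u * x i) n lam * evenRows lam =
        ∑' k, (u : ℝ≥0∞) ^ k * {lam | lam.IsEvenOfCard k}.indicator (schurSum x n) lam := by
    by_cases h : ∀ i, 2 ∣ lam.rowLen i
    · obtain ⟨m, hm⟩ := two_dvd_card h
      rw [tsum_eq_single m]
      · rw [Set.indicator_of_mem (show lam ∈ {lam | lam.IsEvenOfCard m} from
            ⟨hm, forall_even_rowLens_iff.2 h⟩), evenRows, if_pos h,
          schurSum_mul, mul_one, hm, pow_mul, ← ENNReal.coe_pow, NNReal.sq_sqrt]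
      · intro k hk
        rw [Set.indicator_of_notMem, mul_zero]
        rintro ⟨h1, -⟩
        omega
    · have h0 (k : ℕ) : lam ∉ {lam : YoungDiagram | lam.IsEvenOfCard k} :=
        fun h' => h (forall_even_rowLens_iff.1 h'.2)
      simp [evenRows, h, h0]
  have hprod (u : ℝ≥0) :
      ∏ p : {p : Fin n × Fin n // p.1 ≤ p.2}, ∑' d : ℕ,
        ((NNReal.sqrt u * x p.1.1) * (NNReal.sqrt u * x p.1.2)) ^ d =
      ∑' k, (u : ℝ≥0∞) ^ k * ∑ s : Sym {p : Fin n × Fin n // p.1 ≤ p.2} k,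
        (s.1.map fun p => x p.1.1 * x p.1.2).prod := by
    have hu : (NNReal.sqrt u : ℝ≥0∞) * NNReal.sqrt u = u := by
      rw [← ENNReal.coe_mul, NNReal.mul_self_sqrt]
    simp only [mul_mul_mul_comm _ (x _), hu]
    rw [ENNReal.prod_tsum_pow]
    simp only [Finset.mul_sum, Multiset.prod_map_mul, Multiset.map_const', Multiset.prod_replicate,
      Sym.val_eq_coe, Sym.card_coe]
  have hmain (u : ℝ≥0) :
      ∑' k, (u : ℝ≥0∞) ^ k * ∑' lam : {lam : YoungDiagram // lam.IsEvenOfCard k},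
        schurSum x n lam =
      ∑' k, (u : ℝ≥0∞) ^ k * ∑ s : Sym {p : Fin n × Fin n // p.1 ≤ p.2} k,
        (s.1.map fun p => x p.1.1 * x p.1.2).prod := by
    rw [← hprod, ← Finset.prod_range_prod_range_succ n fun i j => ∑' d : ℕ,
        ((NNReal.sqrt u * x i) * (NNReal.sqrt u * x j)) ^ d,
      ← tsum_schurSum_mul_evenRows fun i => NNReal.sqrt u * x i]
    simp only [heven]
    rw [ENNReal.tsum_comm]
    refine tsum_congr fun k => ?_
    rw [ENNReal.tsum_mul_left]
    exact congrArg _ (tsum_subtype {lam : YoungDiagram | lam.IsEvenOfCard k} (schurSum x n))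
  refine ENNReal.coeff_eq_of_tsum_eq hmain ?_ k
  have h1 := hprod 1
  simp only [NNReal.sqrt_one, ENNReal.coe_one, one_mul, one_pow] at h1
  rw [← h1]
  refine ENNReal.prod_ne_top fun p _ => ?_
  rw [ENNReal.tsum_geometric]
  exact ENNReal.inv_ne_top.2 (tsub_pos_of_lt (mul_lt_one_of_nonneg_of_lt_one_left zero_le
    (hx _) (hx _).le)).ne'

instance YoungDiagram.finite_isEvenOfCard (k : ℕ) :
    Finite {lam : YoungDiagram // lam.IsEvenOfCard k} := by
  refine Finite.of_injective (β := (Finset.range (2 * k) ×ˢ Finset.range (2 * k)).powerset)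
    (fun lam => ⟨lam.1.cells, Finset.mem_powerset.2 ?_⟩)
    fun lam lam' h => Subtype.ext (YoungDiagram.ext (Subtype.mk.inj h))
  rintro ⟨i, j⟩ hc
  rw [mem_cells] at hc
  have hcard := lam.2.1
  have hrow : lam.1.rowLen i ≤ lam.1.card := by
    rw [rowLen_eq_card]
    exact Finset.card_filter_le _ _
  have hcol : lam.1.colLen j ≤ lam.1.card := by
    rw [colLen_eq_card]
    exact Finset.card_filter_le _ _
  have := mem_iff_lt_rowLen.1 hc
  have := mem_iff_lt_colLen.1 hc
  simp only [Finset.mem_product, Finset.mem_range]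
  omega

instance SemistandardYoungTableau.finite_isBounded (n : ℕ) (lam : YoungDiagram) :
    Finite {T : SemistandardYoungTableau lam // T.IsBounded n} := by
  refine Finite.of_injective (β := lam.cells → Fin n) (fun T c => ⟨T.1 c.1.1 c.1.2, T.2 c.1 c.2⟩)
    fun T T' h => Subtype.ext (SemistandardYoungTableau.ext fun i j => ?_)
  by_cases hc : (i, j) ∈ lam
  · exact Fin.mk.inj (congrFun h ⟨(i, j), hc⟩)
  · rw [T.1.zeros hc, T'.1.zeros hc]

theorem SemistandardYoungTableau.IsBounded.prod_pow_ssytWeight {M : Type*} [CommMonoid M]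
    {n : ℕ} {lam : YoungDiagram} {T : SemistandardYoungTableau lam} (hT : T.IsBounded n)
    (z : ℕ → M) : ∏ i : Fin n, z i ^ ssytWeight T i = ∏ c ∈ lam.cells, z (T c.1 c.2) := by
  rw [← Finset.prod_range fun i => z i ^ ssytWeight T i,
    ← Finset.prod_fiberwise_of_maps_to' (t := Finset.range n) (fun c hc =>
      Finset.mem_range.2 (hT c hc)) z]
  exact Finset.prod_congr rfl fun i _ => (Finset.prod_const _).symm

section

open MvPolynomial

theorem exists_eval₂_schurPoly (z : ℕ → ℝ≥0) (n : ℕ) (lam : YoungDiagram) :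
    ∃ q : ℝ≥0, eval₂Hom (Int.castRingHom ℝ) (fun i : Fin n => (z i : ℝ)) (schurPoly n lam) = q ∧
      schurSum (fun i => z i) n lam = q := by
  have := Fintype.ofFinite {T : SemistandardYoungTableau lam // T.IsBounded n}
  refine ⟨∑ T : {T : SemistandardYoungTableau lam // T.IsBounded n},
    ∏ c ∈ lam.cells, z (T.1 c.1 c.2), ?_, ?_⟩
  · have h : schurPoly n lam = ∑ T : {T : SemistandardYoungTableau lam // T.IsBounded n},
        ∏ i : Fin n, X i ^ ssytWeight T.1 i :=
      (finsum_subtype_eq_finsum_cond (IsBounded n)).symm.trans (finsum_eq_sum_of_fintype _)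
    rw [h, map_sum, NNReal.coe_sum]
    refine Finset.sum_congr rfl fun T _ => ?_
    rw [← T.2.prod_pow_ssytWeight]
    simp
  · rw [schurSum, tsum_fintype]
    push_cast
    rfl

theorem eval₂_hsymm_eq_eval₂_finsum_schurPoly (z : ℕ → ℝ≥0) (hz : ∀ i, z i < 1) (n k : ℕ) :
    eval₂Hom (Int.castRingHom ℝ) (fun i : Fin n => (z i : ℝ))
      (aeval (fun p : {p : Fin n × Fin n // p.1 ≤ p.2} =>
        (X p.1.1 : MvPolynomial (Fin n) ℤ) * X p.1.2)
          (hsymm {p : Fin n × Fin n // p.1 ≤ p.2} ℤ k)) =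
    eval₂Hom (Int.castRingHom ℝ) (fun i : Fin n => (z i : ℝ))
      (∑ᶠ (lam : YoungDiagram) (_ : lam.IsEvenOfCard k), schurPoly n lam) := by
  have := Fintype.ofFinite {lam : YoungDiagram // lam.IsEvenOfCard k}
  choose q hq hq' using exists_eval₂_schurPoly z n
  have hleft : eval₂Hom (Int.castRingHom ℝ) (fun i : Fin n => (z i : ℝ))
      (aeval (fun p : {p : Fin n × Fin n // p.1 ≤ p.2} =>
        (X p.1.1 : MvPolynomial (Fin n) ℤ) * X p.1.2)
          (hsymm {p : Fin n × Fin n // p.1 ≤ p.2} ℤ k)) =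
      (∑ s : Sym {p : Fin n × Fin n // p.1 ≤ p.2} k,
        (s.1.map fun p => z p.1.1 * z p.1.2).prod : ℝ≥0) := by
    rw [hsymm, map_sum, map_sum, NNReal.coe_sum]
    refine Finset.sum_congr rfl fun s _ => ?_
    rw [map_multiset_prod, map_multiset_prod, NNReal.coe_multiset_prod, Multiset.map_map,
      Multiset.map_map, Multiset.map_map]
    congr 1
    exact Multiset.map_congr rfl fun p _ => by simp
  have hgraded := tsum_schurSum_isEvenOfCard (fun i => z i) (fun i => by exact_mod_cast hz i) n k
  rw [hleft, ← finsum_subtype_eq_finsum_cond, finsum_eq_sum_of_fintype, map_sum]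
  simp only [hq]
  rw [← NNReal.coe_sum, NNReal.coe_inj, ← ENNReal.coe_inj, ENNReal.ofNNReal_finsetSum,
    ENNReal.ofNNReal_finsetSum]
  rw [tsum_fintype] at hgraded
  simp only [hq'] at hgraded
  rw [hgraded]
  refine Finset.sum_congr rfl fun s _ => ?_
  refine (map_multiset_prod ENNReal.ofNNRealHom _).trans ?_
  rw [Multiset.map_map]
  congr 1

end

open MvPolynomial in
/-- **Character identity for `Sym^k(Sym² C^n)`.** The complete homogeneous symmetric polynomial
of degree `k` in the `n(n+1)/2` variables `{x_i x_j : i ≤ j}` equals the sum of the Schur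
polynomials `s_λ(x_1,…,x_n)` over partitions `λ` of `2k` with all parts even. -/
theorem sym_sym_characters (n k : ℕ) (hn : 0 < n) :
    aeval (fun p : {p : Fin n × Fin n // p.1 ≤ p.2} =>
          (X p.1.1 : MvPolynomial (Fin n) ℤ) * X p.1.2)
        (hsymm {p : Fin n × Fin n // p.1 ≤ p.2} ℤ k) =
      ∑ᶠ (lam : YoungDiagram)
        (_ : lam.card = 2 * k ∧ ∀ r ∈ lam.rowLens, Even r),
        schurPoly n lam := by
  refine map_injective (Int.castRingHom ℝ) Int.cast_injective ?_
  refine funext_set (fun _ => Set.Ioo 0 1) (fun _ => Set.Ioo_infinite one_pos) fun y hy => ?_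
  have hy (i : Fin n) : 0 < y i ∧ y i < 1 := hy i (Set.mem_univ i)
  have h := eval₂_hsymm_eq_eval₂_finsum_schurPoly
    (fun i => if h : i < n then (y ⟨i, h⟩).toNNReal else 0)
    (fun i => by
      split_ifs
      · exact Real.toNNReal_lt_one.2 (hy _).2
      · exact one_pos) n k
  simp only [Fin.is_lt, dite_true, Fin.eta, Real.coe_toNNReal _ (hy _).1.le, coe_eval₂Hom] at h
  rw [eval_map, eval_map]
  exact h
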